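/- Fix z ∈ ℝ with z ≠ 0. The function p ↦ J(p,z) := −z·p·e^{−z} + (1 − p·e^{−z})·ln((1 − p·e^{−z})/(1−p)) is strictly increasing in p on the interval (0, min(1, e^{z})). Consequently, the rate of convergence J(p,z) decreases, for every fixed z ≠ 0, as the tail probability p decreases. -/

import Mathlib

/-- The centered rate function `J_p(z)` (as a function of the tail probability `p`
and `z`), with the convention `0 * log 0 = 0` (automatic since `Real.log 0 = 0`). -/
noncomputable def Jfun (p z : ℝ) : ℝ :=
  -z * p * Real.exp (-z) +
    (1 - p * Real.exp (-z)) * Real.log ((1 - p * Real.exp (-z)) / (1 - p))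

/-- The derivative of the rate function in the tail probability. -/
theorem hasDerivAt_Jfun {p z : ℝ} (hp : p < 1) (hpz : p * Real.exp (-z) < 1) :
    HasDerivAt (fun p => Jfun p z)
      (-z * Real.exp (-z) -
        Real.exp (-z) * Real.log ((1 - p * Real.exp (-z)) / (1 - p)) - Real.exp (-z) +
        (1 - p * Real.exp (-z)) / (1 - p)) p := by
  have h₁ : 1 - p ≠ 0 := (sub_pos.2 hp).ne'
  have h₂ : 1 - p * Real.exp (-z) ≠ 0 := (sub_pos.2 hpz).ne'
  have hu : HasDerivAt (fun p : ℝ => 1 - p * Real.exp (-z)) (-(1 * Real.exp (-z))) p :=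
    ((hasDerivAt_id p).mul_const _).const_sub 1
  have hv : HasDerivAt (fun p : ℝ => 1 - p) (-1) p := (hasDerivAt_id p).const_sub 1
  have hw : HasDerivAt (fun p : ℝ => -z * p * Real.exp (-z)) (-z * 1 * Real.exp (-z)) p :=
    ((hasDerivAt_id p).const_mul (-z)).mul_const _
  refine (hw.add (hu.mul ((hu.div hv h₁).log (div_ne_zero h₂ h₁)))).congr_deriv ?_
  simp only [Pi.div_apply]
  generalize Real.log _ = L
  generalize Real.exp (-z) = a at h₂ ⊢
  rw [mul_comm] at h₂
  field_simp
  ring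

/-- The derivative of the rate function in the tail probability is positive for `z ≠ 0`. -/
theorem deriv_Jfun_pos {p z : ℝ} (hz : z ≠ 0) (hp : p < 1) (hpz : p * Real.exp (-z) < 1) :
    0 < deriv (fun p => Jfun p z) p := by
  rw [(hasDerivAt_Jfun hp hpz).deriv]
  have h₁ : 0 < 1 - p := sub_pos.2 hp
  have h₂ : 0 < 1 - p * Real.exp (-z) := sub_pos.2 hpz
  have ha : 0 < Real.exp (-z) := Real.exp_pos _
  have hr : 0 < (1 - p * Real.exp (-z)) / (1 - p) := div_pos h₂ h₁
  have hne : (1 - p * Real.exp (-z)) / (1 - p) / Real.exp (-z) ≠ 1 := by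
    rw [Ne, div_eq_one_iff_eq ha.ne', div_eq_iff h₁.ne']
    intro h
    have : Real.exp (-z) = 1 := by linarith
    exact hz (neg_eq_zero.1 (Real.exp_eq_one_iff _ |>.1 this))
  have hlog := Real.log_lt_sub_one_of_pos (div_pos hr ha) hne
  rw [Real.log_div hr.ne' ha.ne', Real.log_exp, lt_sub_iff_add_lt, lt_div_iff₀ ha] at hlog
  linarith

theorem stmt11 (z : ℝ) (hz : z ≠ 0) :
    StrictMonoOn (fun p => Jfun p z) (Set.Ioo (0:ℝ) (min 1 (Real.exp z))) := by
  have hlt : ∀ p ∈ Set.Ioo (0 : ℝ) (min 1 (Real.exp z)), p < 1 ∧ p * Real.exp (-z) < 1 := by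
    intro p hp
    obtain ⟨h₁, h₂⟩ := lt_min_iff.1 hp.2
    refine ⟨h₁, ?_⟩
    rwa [Real.exp_neg, ← div_eq_mul_inv, div_lt_one (Real.exp_pos z)]
  refine strictMonoOn_of_deriv_pos (convex_Ioo _ _) (fun p hp => ?_) (fun p hp => ?_)
  · exact (hasDerivAt_Jfun (hlt p hp).1 (hlt p hp).2).continuousAt.continuousWithinAt
  · rw [interior_Ioo] at hp
    exact deriv_Jfun_pos hz (hlt p hp).1 (hlt p hp).2
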